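/- arXiv:1407.6178 — 6 statements merged into one kernel-verified Lean document; each statement's English description precedes it below -/
import Mathlib

section
/- Let G = (V,E) be a strongly connected finite simple directed graph and let x, y be distinct vertices of G. Then there exist two vertex-disjoint paths from x to y and two vertex-disjoint paths from y to x in G if and only if (i) for every vertex w ∈ V \ {x,y}, the vertices x and y lie in the same strongly connected component of the graph G − w obtained by deleting w, and (ii) x and y lie in the same strongly connected component of the graph obtained from G by deleting both edges (x,y) and (y,x) (those of them that are present). -/
variable {V : Type*}

/-- `p` is a simple directed path from `x` to `y` w.r.t. the edge relation `E`. -/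
def IsDipath (E : V → V → Prop) (x y : V) (p : List V) : Prop :=
  List.Chain' E p ∧ p.head? = some x ∧ p.getLast? = some y ∧ p.Nodup

/-- The edges of a path, as the list of consecutive pairs. -/
def dipathEdges (p : List V) : List (V × V) := p.zip p.tail

/-- There are two (distinct, internally vertex-disjoint) paths from `x` to `y`:
they share no vertices other than `x` and `y`. -/
def TwoVDP (E : V → V → Prop) (x y : V) : Prop :=
  ∃ p q : List V, IsDipath E x y p ∧ IsDipath E x y q ∧ p ≠ q ∧
    ∀ z, z ∈ p → z ∈ q → z = x ∨ z = y

/-- There are two edge-disjoint paths from `x` to `y`. -/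
def TwoEDP (E : V → V → Prop) (x y : V) : Prop :=
  ∃ p q : List V, IsDipath E x y p ∧ IsDipath E x y q ∧
    ∀ e, e ∈ dipathEdges p → e ∉ dipathEdges q

/-- Reachability in a digraph. -/
def DiReach (E : V → V → Prop) (x y : V) : Prop := Relation.ReflTransGen E x y

/-- `x` and `y` lie in the same strongly connected component. -/
def InSameSCC (E : V → V → Prop) (x y : V) : Prop := DiReach E x y ∧ DiReach E y x

/-- The digraph is strongly connected. -/
def IsStronglyConn (E : V → V → Prop) : Prop := ∀ x y, DiReach E x y

/-- Deleting a vertex `w` (and its incident edges). -/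
def DelVertex (E : V → V → Prop) (w : V) : V → V → Prop :=
  fun a b => E a b ∧ a ≠ w ∧ b ≠ w

/-- `x ↔² y` : two vertex-disjoint paths in both directions. -/
def Rel2d (E : V → V → Prop) (x y : V) : Prop :=
  x ≠ y ∧ TwoVDP E x y ∧ TwoVDP E y x

/-- `x ↔^{2s} y`. -/
def Rel2s (E : V → V → Prop) (x y : V) : Prop :=
  x ≠ y ∧ ∀ z, z ≠ x → z ≠ y → InSameSCC (DelVertex E z) x y

/-- `x ↔^{2e} y` : two edge-disjoint paths in both directions. -/
def Rel2e (E : V → V → Prop) (x y : V) : Prop :=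
  x ≠ y ∧ TwoEDP E x y ∧ TwoEDP E y x

/-- A maximal vertex set of size ≥ `k` all of whose pairs of distinct elements
satisfy the relation `R` (e.g. a 2-directed/2-strong/2-edge block). -/
def IsMaxBlock (R : V → V → Prop) (k : ℕ) (C : Set V) : Prop :=
  k ≤ C.ncard ∧ (∀ x ∈ C, ∀ y ∈ C, x ≠ y → R x y) ∧
    ∀ D : Set V, C ⊆ D → (∀ x ∈ D, ∀ y ∈ D, x ≠ y → R x y) → D = C

theorem rtg_mono {V : Type*} {r p : V → V → Prop} {a b : V}
    (h : Relation.ReflTransGen r a b) (hrp : ∀ u v, r u v → p u v) :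
    Relation.ReflTransGen p a b := by
  induction h with
  | refl => exact .refl
  | tail _ h ih => exact ih.tail (hrp _ _ h)

theorem dipath_reach {V : Type*} (E : V → V → Prop) (p : List V) : ∀ a b : V,
    List.IsChain E p → p.head? = some a → p.getLast? = some b →
    Relation.ReflTransGen (fun u v => E u v ∧ u ∈ p ∧ v ∈ p) a b := by
  induction p with
  | nil => intro a b _ h; simp at h
  | cons c l ih =>
    intro a b hc hh hl
    simp only [List.head?_cons, Option.some.injEq] at hh
    subst hh
    cases l with
    | nil =>
      simp at hl
      subst hl
      exact Relation.ReflTransGen.refl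
    | cons d l =>
      rw [List.isChain_cons_cons] at hc
      rw [List.getLast?_cons_cons] at hl
      have h := ih d b hc.2 rfl hl
      refine Relation.ReflTransGen.head ⟨hc.1, by simp, by simp⟩ (rtg_mono h ?_)
      rintro u v ⟨h1, h2, h3⟩
      exact ⟨h1, List.mem_cons_of_mem _ h2, List.mem_cons_of_mem _ h3⟩

theorem exists_dipath {V : Type*} (E : V → V → Prop) (S : Set V) (x y : V) (hy : y ∈ S)
    (h : Relation.ReflTransGen (fun u v => E u v ∧ u ∈ S ∧ v ∈ S) x y) :
    ∃ p, (List.IsChain E p ∧ p.head? = some x ∧ p.getLast? = some y ∧ p.Nodup) ∧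
      ∀ z ∈ p, z ∈ S := by
  induction h using Relation.ReflTransGen.head_induction_on with
  | refl => exact ⟨[y], by simp, by simpa using hy⟩
  | @head a c hac _ ih =>
    obtain ⟨p, ⟨h1, h2, h3, h4⟩, h5⟩ := ih
    by_cases ha : a ∈ p
    · obtain ⟨s, t, rfl⟩ := List.append_of_mem ha
      refine ⟨a :: t, ⟨h1.right_of_append, rfl, ?_, ?_⟩, ?_⟩
      · rw [List.getLast?_append_of_ne_nil _ (by simp)] at h3
        exact h3
      · exact (List.nodup_append.1 h4).2.1
      · intro z hz
        exact h5 z (List.mem_append_right _ hz)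
    · cases p with
      | nil => simp at h2
      | cons d l =>
        simp only [List.head?_cons, Option.some.injEq] at h2
        subst h2
        refine ⟨a :: d :: l, ⟨List.isChain_cons_cons.2 ⟨hac.1, h1⟩, rfl, ?_, ?_⟩, ?_⟩
        · rw [List.getLast?_cons_cons]; exact h3
        · exact List.nodup_cons.2 ⟨ha, h4⟩
        · intro z hz
          rcases List.mem_cons.1 hz with rfl | hz
          · exact hac.2.1
          · exact h5 z hz

/-- There is a walk from `A` to `B` all of whose vertices lie in `S`. -/
def Link {V : Type*} (E : V → V → Prop) (A B S : Set V) : Prop :=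
  ∃ a ∈ A, ∃ b ∈ B, a ∈ S ∧ Relation.ReflTransGen (fun u v => E u v ∧ u ∈ S ∧ v ∈ S) a b

theorem Link.mono {V : Type*} {E E' : V → V → Prop} {A B S S' : Set V}
    (hE : ∀ u v, E u v → E' u v) (hS : S ⊆ S') (h : Link E A B S) : Link E' A B S' := by
  obtain ⟨a, ha, b, hb, hs, hr⟩ := h
  exact ⟨a, ha, b, hb, hS hs, rtg_mono hr fun u v h => ⟨hE _ _ h.1, hS h.2.1, hS h.2.2⟩⟩

theorem reach_mem {V : Type*} {E : V → V → Prop} {S : Set V} {a b : V} (ha : a ∈ S)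
    (h : Relation.ReflTransGen (fun u v => E u v ∧ u ∈ S ∧ v ∈ S) a b) : b ∈ S := by
  cases h with
  | refl => exact ha
  | tail _ h => exact h.2.2

theorem Link.swap {V : Type*} {E : V → V → Prop} {A B S : Set V}
    (h : Link E A B S) : Link (fun u v => E v u) B A S := by
  obtain ⟨a, ha, b, hb, hs, hr⟩ := h
  refine ⟨b, hb, a, ha, reach_mem hs hr, ?_⟩
  refine rtg_mono (Relation.reflTransGen_swap.2 hr) ?_
  rintro u v ⟨h1, h2, h3⟩
  exact ⟨h1, h3, h2⟩

theorem Link.trans {V : Type*} {E : V → V → Prop} {A B S : Set V} {z : V}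
    (h : Link E A {z} S) (h' : Link E {z} B S) : Link E A B S := by
  obtain ⟨a, ha, b, rfl, hs, hr⟩ := h
  obtain ⟨c, rfl, d, hd, hs', hr'⟩ := h'
  exact ⟨a, ha, d, hd, hs, hr.trans hr'⟩

theorem Link.snoc {V : Type*} {E : V → V → Prop} {A S : Set V} {z z' : V}
    (h : Link E A {z} S) (hz : E z z') (hz' : z' ∈ S) : Link E A {z'} S := by
  obtain ⟨a, ha, b, rfl, hs, hr⟩ := h
  exact ⟨a, ha, z', rfl, hs, hr.tail ⟨hz, reach_mem hs hr, hz'⟩⟩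

theorem Link.tgt {V : Type*} {E : V → V → Prop} {A B S : Set V} {z : V}
    (h : Link E A {z} S) (hz : z ∈ B) : Link E A B S := by
  obtain ⟨a, ha, b, rfl, hs, hr⟩ := h
  exact ⟨a, ha, b, hz, hs, hr⟩

theorem link_half {V : Type*} {E E' : V → V → Prop} {A B : Set V} {a b w : V}
    (hE : ∀ u v, E u v → E' u v ∨ (u = a ∧ v = b))
    (h : ∀ u, Link E A B {u}ᶜ) (hw : ¬ Link E' A B {w}ᶜ) (u : V) :
    Link E' A {w, a} {u}ᶜ := by
  by_contra hcon
  obtain ⟨a0, ha0, b0, hb0, hs, hr⟩ := h u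
  have key : Link E' A {b0} {w}ᶜ ∧ Link E' A {b0} {u}ᶜ := by
    clear hb0
    induction hr with
    | refl =>
      have h2 : Link E' A {a0} {u}ᶜ := ⟨a0, ha0, a0, rfl, hs, .refl⟩
      refine ⟨⟨a0, ha0, a0, rfl, ?_, .refl⟩, h2⟩
      rintro rfl
      exact hcon (h2.tgt (by simp))
    | @tail v v' _ hvv ih =>
      have step : E' v v' := by
        rcases hE _ _ hvv.1 with h | ⟨rfl, -⟩
        · exact h
        · exact absurd (ih.2.tgt (by simp)) hcon
      have h2 := ih.2.snoc step hvv.2.2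
      refine ⟨ih.1.snoc step ?_, h2⟩
      rintro rfl
      exact hcon (h2.tgt (by simp))
  exact hw (key.1.tgt hb0)

theorem link_trim {V : Type*} {E : V → V → Prop} {A C S : Set V} {w : V} (hwC : w ∈ C)
    (h : Link E A C S) : Link E A C {z | z ∈ S ∧ (z = w ∨ Link E A {z} {w}ᶜ)} := by
  by_contra hcon
  obtain ⟨a0, ha0, b0, hb0, hs, hr⟩ := h
  have key : Link E A {b0} {w}ᶜ ∧
      Link E A {b0} {z | z ∈ S ∧ (z = w ∨ Link E A {z} {w}ᶜ)} := by
    clear hb0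
    induction hr with
    | refl =>
      have hne : a0 ≠ w := by
        rintro rfl
        exact hcon ⟨a0, ha0, a0, hwC, ⟨hs, Or.inl rfl⟩, .refl⟩
      have h1 : Link E A {a0} {w}ᶜ := ⟨a0, ha0, a0, rfl, hne, .refl⟩
      exact ⟨h1, ⟨a0, ha0, a0, rfl, ⟨hs, Or.inr h1⟩, .refl⟩⟩
    | @tail v v' _ hvv ih =>
      by_cases hv : v' = w
      · subst hv
        exact absurd ((ih.2.snoc hvv.1 ⟨hvv.2.2, Or.inl rfl⟩).tgt hwC) hcon
      · have h1 := ih.1.snoc hvv.1 hv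
        exact ⟨h1, ih.2.snoc hvv.1 ⟨hvv.2.2, Or.inr h1⟩⟩
  exact hcon (key.2.tgt hb0)

theorem link_pair {V : Type*} {E : V → V → Prop} {A S T : Set V} {w a : V}
    (hd : Disjoint S T) (hS : Link E A {w, a} S) (hT : Link E A {w, a} T) :
    (Link E A {w} S ∧ Link E A {a} T) ∨ (Link E A {w} T ∧ Link E A {a} S) := by
  obtain ⟨a1, h1, b1, hb1, hs1, hr1⟩ := hS
  obtain ⟨a2, h2, b2, hb2, hs2, hr2⟩ := hT
  have m1 := reach_mem hs1 hr1
  have m2 := reach_mem hs2 hr2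
  have hne : b1 ≠ b2 := by
    rintro rfl
    exact Set.disjoint_left.1 hd m1 m2
  rcases hb1 with rfl | rfl <;> rcases hb2 with rfl | rfl
  · exact absurd rfl hne
  · exact Or.inl ⟨⟨a1, h1, _, rfl, hs1, hr1⟩, ⟨a2, h2, _, rfl, hs2, hr2⟩⟩
  · exact Or.inr ⟨⟨a2, h2, _, rfl, hs2, hr2⟩, ⟨a1, h1, _, rfl, hs1, hr1⟩⟩
  · exact absurd rfl hne

/-- Output of the induction on one side, trimmed. -/
theorem link_side {V : Type*} {E : V → V → Prop} {A : Set V} {w a : V}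
    (h : ∃ S T : Set V, Disjoint S T ∧ Link E A {w, a} S ∧ Link E A {w, a} T) :
    ∃ S T : Set V, Disjoint S T ∧ Link E A {w} S ∧ Link E A {a} T ∧
      (∀ z ∈ S, z = w ∨ Link E A {z} {w}ᶜ) ∧ (∀ z ∈ T, z = w ∨ Link E A {z} {w}ᶜ) := by
  obtain ⟨S, T, hd, hS, hT⟩ := h
  have hS' := link_trim (w := w) (by simp) hS
  have hT' := link_trim (w := w) (by simp) hT
  have hd' : Disjoint {z | z ∈ S ∧ (z = w ∨ Link E A {z} {w}ᶜ)}
      {z | z ∈ T ∧ (z = w ∨ Link E A {z} {w}ᶜ)} :=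
    hd.mono (fun z hz => hz.1) (fun z hz => hz.1)
  rcases link_pair hd' hS' hT' with ⟨h1, h2⟩ | ⟨h1, h2⟩
  · exact ⟨_, _, hd', h1, h2, fun z hz => hz.2, fun z hz => hz.2⟩
  · exact ⟨_, _, hd'.symm, h1, h2, fun z hz => hz.2, fun z hz => hz.2⟩

theorem Link.end_mem {V : Type*} {E : V → V → Prop} {A S : Set V} {z : V}
    (h : Link E A {z} S) : z ∈ S := by
  obtain ⟨a, ha, b, rfl, hs, hr⟩ := h
  exact reach_mem hs hr

theorem menger_two {V : Type*} [DecidableEq V] [Nonempty V] (s : Finset (V × V)) :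
    ∀ A B : Set V, (∀ w, Link (fun u v => (u, v) ∈ s) A B {w}ᶜ) →
    ∃ S T : Set V, Disjoint S T ∧ Link (fun u v => (u, v) ∈ s) A B S ∧
      Link (fun u v => (u, v) ∈ s) A B T := by
  induction s using Finset.induction_on with
  | empty =>
    intro A B h
    have h' : ∀ w : V, ∃ a ∈ A, a ∈ B ∧ a ≠ w := by
      intro w
      obtain ⟨a, ha, b, hb, hs, hr⟩ := h w
      cases hr with
      | refl => exact ⟨a, ha, hb, hs⟩
      | tail _ h => simp at h
    obtain ⟨c, hc, hc', -⟩ := h' (Classical.arbitrary V)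
    obtain ⟨d, hd, hd', hne⟩ := h' c
    exact ⟨{c}, {d}, by simpa using hne.symm, ⟨c, hc, c, hc', rfl, .refl⟩,
      ⟨d, hd, d, hd', rfl, .refl⟩⟩
  | insert e s _ ih =>
    obtain ⟨a, b⟩ := e
    intro A B h
    have hmono : ∀ u v, (u, v) ∈ s → (u, v) ∈ insert (a, b) s :=
      fun u v h => Finset.mem_insert_of_mem h
    by_cases hall : ∀ w, Link (fun u v => (u, v) ∈ s) A B {w}ᶜ
    · obtain ⟨S, T, hd, hS, hT⟩ := ih A B hall
      exact ⟨S, T, hd, hS.mono hmono subset_rfl, hT.mono hmono subset_rfl⟩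
    push Not at hall
    obtain ⟨w, hw⟩ := hall
    have hE : ∀ u v, (u, v) ∈ insert (a, b) s → (u, v) ∈ s ∨ (u = a ∧ v = b) := by
      intro u v h
      simp only [Finset.mem_insert, Prod.mk.injEq] at h
      tauto
    have hA := link_side (ih A {w, a} (link_half hE h hw))
    have hB0 := link_half (E := fun u v => (v, u) ∈ insert (a, b) s)
      (E' := fun u v => (v, u) ∈ s) (A := B) (B := A) (a := b) (b := a) (w := w)
      (fun u v h => (hE v u h).imp_right And.symm)
      (fun u => (h u).swap) (fun hc => hw hc.swap)
    obtain ⟨S0, T0, hd0, hS0, hT0⟩ := ih {w, b} B (fun u => (hB0 u).swap)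
    have hB := link_side ⟨S0, T0, hd0, hS0.swap, hT0.swap⟩
    obtain ⟨S1, T1, hd1, hS1, hT1, tS1, tT1⟩ := hA
    obtain ⟨S2, T2, hd2, hS2, hT2, tS2, tT2⟩ := hB
    have cross : ∀ z, (z = w ∨ Link (fun u v => (u, v) ∈ s) A {z} {w}ᶜ) →
        (z = w ∨ Link (fun u v => (v, u) ∈ s) B {z} {w}ᶜ) → z = w := by
      rintro z (h1 | h1) (h2 | h2)
      · exact h1
      · exact h1
      · exact h2
      · exact absurd (h1.trans h2.swap) hw
    rw [Set.disjoint_left] at hd1 hd2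
    refine ⟨S1 ∪ S2, T1 ∪ T2, ?_, ?_, ?_⟩
    · rw [Set.disjoint_left]
      rintro z (hz | hz) (hz' | hz')
      · exact hd1 hz hz'
      · have := cross z (tS1 z hz) (tT2 z hz')
        subst this
        exact hd2 hS2.end_mem hz'
      · have := cross z (tT1 z hz') (tS2 z hz)
        subst this
        exact hd1 hS1.end_mem hz'
      · exact hd2 hz hz'
    · exact (hS1.mono hmono Set.subset_union_left).trans
        (hS2.swap.mono hmono Set.subset_union_right)
    · refine Link.trans (z := b) ?_ (hT2.swap.mono hmono Set.subset_union_right)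
      exact (hT1.mono hmono Set.subset_union_left).snoc (Finset.mem_insert_self _ _)
        (Or.inr hT2.end_mem)

theorem twoVDP_of {V : Type*} [Fintype V] (E : V → V → Prop) (x y : V) (hxy : x ≠ y)
    (hr : Relation.ReflTransGen E x y)
    (hw : ∀ w, w ≠ x → w ≠ y → Relation.ReflTransGen (DelVertex E w) x y)
    (he : Relation.ReflTransGen
      (fun a b => E a b ∧ ¬(a = x ∧ b = y) ∧ ¬(a = y ∧ b = x)) x y) : TwoVDP E x y := by
  classical
  by_cases hE : E x y
  · obtain ⟨p, ⟨h1, h2, h3, h4⟩, -⟩ := exists_dipath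
      (fun a b => E a b ∧ ¬(a = x ∧ b = y) ∧ ¬(a = y ∧ b = x)) Set.univ x y trivial
      (rtg_mono he fun u v h => ⟨h, trivial, trivial⟩)
    refine ⟨[x, y], p, ⟨?_, rfl, rfl, ?_⟩, ⟨h1.imp fun u v h => h.1, h2, h3, h4⟩, ?_, ?_⟩
    · exact List.isChain_pair.2 hE
    · simpa using hxy
    · rintro rfl
      have := List.isChain_pair.1 h1
      exact this.2.1 ⟨rfl, rfl⟩
    · intro z hz _
      simpa using hz
  · let s : Finset (V × V) := Finset.univ.filter fun e =>
      E e.1 e.2 ∧ (e.1 ≠ x ∧ e.1 ≠ y) ∧ (e.2 ≠ x ∧ e.2 ≠ y)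
    have hs : ∀ u v, (u, v) ∈ s ↔ E u v ∧ (u ≠ x ∧ u ≠ y) ∧ (v ≠ x ∧ v ≠ y) := by
      intro u v; simp [s]
    let A : Set V := {u | E x u ∧ u ≠ x ∧ u ≠ y}
    let B : Set V := {u | E u y ∧ u ≠ x ∧ u ≠ y}
    have key : ∀ (w : V) (F : V → V → Prop),
        (∀ u v, F u v → E u v ∧ (v ≠ x → v ≠ y → v ≠ w)) →
        Relation.ReflTransGen F x y → Link (fun u v => (u, v) ∈ s) A B {w}ᶜ := by
      intro w F hF h
      have : ∀ v, Relation.ReflTransGen F x v → Link (fun u v => (u, v) ∈ s) A B {w}ᶜ ∨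
          v = x ∨ (v ≠ x ∧ v ≠ y ∧ Link (fun u v => (u, v) ∈ s) A {v} {w}ᶜ) := by
        intro v hv
        induction hv with
        | refl => exact Or.inr (Or.inl rfl)
        | @tail v v' _ hvv ih =>
          obtain ⟨hvE, hvw⟩ := hF _ _ hvv
          rcases ih with ih | rfl | ⟨h1, h2, h3⟩
          · exact Or.inl ih
          · by_cases e1 : v' = v
            · exact Or.inr (Or.inl e1)
            by_cases e2 : v' = y
            · subst e2; exact absurd hvE hE
            exact Or.inr (Or.inr ⟨e1, e2, v', ⟨hvE, e1, e2⟩, v', rfl, hvw e1 e2, .refl⟩)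
          · by_cases e1 : v' = x
            · exact Or.inr (Or.inl e1)
            by_cases e2 : v' = y
            · subst e2
              exact Or.inl (h3.tgt ⟨hvE, h1, h2⟩)
            exact Or.inr (Or.inr ⟨e1, e2, h3.snoc ((hs _ _).2 ⟨hvE, ⟨h1, h2⟩, e1, e2⟩)
              (hvw e1 e2)⟩)
      rcases this y h with h | h | h
      · exact h
      · exact absurd h.symm hxy
      · exact absurd rfl h.2.1
    have hall : ∀ w, Link (fun u v => (u, v) ∈ s) A B {w}ᶜ := by
      intro w
      by_cases e1 : w = x
      · exact key w E (fun u v h => ⟨h, fun h1 h2 => e1 ▸ h1⟩) hr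
      by_cases e2 : w = y
      · exact key w E (fun u v h => ⟨h, fun h1 h2 => e2 ▸ h2⟩) hr
      exact key w _ (fun u v h => ⟨h.1, fun _ _ => h.2.2⟩) (hw w e1 e2)
    haveI : Nonempty V := ⟨x⟩
    obtain ⟨S, T, hd, hS, hT⟩ := menger_two s A B hall
    have mk : ∀ S, Link (fun u v => (u, v) ∈ s) A B S →
        ∃ p, IsDipath E x y p ∧ ∀ z ∈ p, z ∈ S ∪ {x, y} := by
      rintro S ⟨a, ha, b, hb, haS, hab⟩
      have hbS := reach_mem haS hab
      refine exists_dipath E (S ∪ {x, y}) x y (by simp) ?_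
      refine Relation.ReflTransGen.head (b := a) ⟨ha.1, by simp, Or.inl haS⟩ ?_
      refine Relation.ReflTransGen.tail (b := b) (rtg_mono hab ?_) ⟨hb.1, Or.inl hbS, by simp⟩
      rintro u v ⟨h1, h2, h3⟩
      exact ⟨((hs _ _).1 h1).1, Or.inl h2, Or.inl h3⟩
    obtain ⟨p, hp, hpS⟩ := mk S hS
    obtain ⟨q, hq, hqT⟩ := mk T hT
    have hcom : ∀ z, z ∈ p → z ∈ q → z = x ∨ z = y := by
      intro z hz hz'
      rcases hpS z hz with h1 | h1
      · rcases hqT z hz' with h2 | h2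
        · exact absurd h2 (Set.disjoint_left.1 hd h1)
        · exact h2
      · exact h1
    refine ⟨p, q, hp, hq, ?_, hcom⟩
    rintro rfl
    obtain ⟨h1, h2, h3, h4⟩ := hp
    match p, h1, h2, h3, h4, hcom with
    | [], _, h2, _, _, _ => simp at h2
    | [c], _, h2, h3, _, _ =>
      simp at h2 h3
      exact hxy (h2.symm.trans h3)
    | c :: d :: l, h1, h2, h3, h4, hcom =>
      simp only [List.head?_cons, Option.some.injEq] at h2
      subst h2
      have h5 : E c d := (List.isChain_cons_cons.1 h1).1
      rcases hcom d (by simp) (by simp) with rfl | rfl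
      · simp at h4
      · exact hE h5

theorem reach_del {V : Type*} (E : V → V → Prop) (x y w : V)
    (hx : w ≠ x) (hy : w ≠ y) (h : TwoVDP E x y) :
    Relation.ReflTransGen (DelVertex E w) x y := by
  obtain ⟨p, q, hp, hq, -, hcom⟩ := h
  have gen : ∀ p, IsDipath E x y p → w ∉ p → Relation.ReflTransGen (DelVertex E w) x y := by
    intro p hp hwp
    refine rtg_mono (dipath_reach E p x y hp.1 hp.2.1 hp.2.2.1) ?_
    rintro u v ⟨h1, h2, h3⟩
    exact ⟨h1, fun h => hwp (h ▸ h2), fun h => hwp (h ▸ h3)⟩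
  by_cases h1 : w ∈ p
  · by_cases h2 : w ∈ q
    · rcases hcom w h1 h2 with h | h
      · exact absurd h hx
      · exact absurd h hy
    · exact gen q hq h2
  · exact gen p hp h1

theorem reach_edge {V : Type*} (E : V → V → Prop) (x y : V) (hxy : x ≠ y) (h : TwoVDP E x y) :
    Relation.ReflTransGen
      (fun a b => E a b ∧ ¬(a = x ∧ b = y) ∧ ¬(a = y ∧ b = x)) x y := by
  obtain ⟨p, q, hp, hq, hne, -⟩ := h
  have gen : ∀ p, IsDipath E x y p → p ≠ [x, y] → Relation.ReflTransGen
      (fun a b => E a b ∧ ¬(a = x ∧ b = y) ∧ ¬(a = y ∧ b = x)) x y := by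
    rintro p ⟨h1, h2, h3, h4⟩ hpne
    match p, h1, h2, h3, h4, hpne with
    | [], _, h2, _, _, _ => simp at h2
    | [c], _, h2, h3, _, _ =>
      simp at h2 h3
      exact absurd (h2.symm.trans h3) hxy
    | c :: d :: l, h1, h2, h3, h4, hpne =>
      simp only [List.head?_cons, Option.some.injEq] at h2
      subst h2
      have h5 := List.isChain_cons_cons.1 h1
      rw [List.getLast?_cons_cons] at h3
      rw [List.nodup_cons] at h4
      have hdy : d ≠ y := by
        rintro rfl
        cases l with
        | nil => exact hpne rfl
        | cons e l =>
          rw [List.getLast?_cons_cons] at h3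
          exact (List.nodup_cons.1 h4.2).1 (List.mem_of_getLast? h3)
      refine Relation.ReflTransGen.head (b := d) ⟨h5.1, fun h => hdy h.2, fun h => hxy h.1⟩ ?_
      refine rtg_mono (dipath_reach E _ d y h5.2 rfl h3) ?_
      rintro u v ⟨g1, g2, g3⟩
      exact ⟨g1, fun h => h4.1 (h.1 ▸ g2), fun h => h4.1 (h.2 ▸ g3)⟩
  by_cases h1 : p = [x, y]
  · exact gen q hq (fun h => hne (h1.trans h.symm))
  · exact gen p hp h1

/-- Lemma 1: in a strongly connected finite simple digraph, for distinct
`x, y`, there are two vertex-disjoint paths in both directions iff `x, y` are in the same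
SCC of `G − w` for every other vertex `w`, and in the same SCC of `G` minus the edges
`(x,y)` and `(y,x)`. -/
theorem stmt0 {V : Type*} [Fintype V] (E : V → V → Prop)
    (hirr : ∀ v, ¬ E v v) (hsc : IsStronglyConn E) (x y : V) (hxy : x ≠ y) :
    (TwoVDP E x y ∧ TwoVDP E y x) ↔
      ((∀ w : V, w ≠ x → w ≠ y → InSameSCC (DelVertex E w) x y) ∧
        InSameSCC (fun a b => E a b ∧ ¬(a = x ∧ b = y) ∧ ¬(a = y ∧ b = x)) x y) := by
  constructor
  · rintro ⟨h1, h2⟩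
    refine ⟨fun w hx hy => ⟨reach_del E x y w hx hy h1, reach_del E y x w hy hx h2⟩,
      reach_edge E x y hxy h1, ?_⟩
    exact rtg_mono (reach_edge E y x hxy.symm h2) fun u v h => ⟨h.1, h.2.2, h.2.1⟩
  · rintro ⟨h1, h2, h3⟩
    refine ⟨twoVDP_of E x y hxy (hsc x y) (fun w hx hy => (h1 w hx hy).1) h2,
      twoVDP_of E y x hxy.symm (hsc y x) (fun w hy hx => (h1 w hx hy).2) ?_⟩
    exact rtg_mono h3 fun u v h => ⟨h.1, h.2.2, h.2.1⟩
end

section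
/- Let G = (V,E) be a strongly connected finite simple directed graph and let C₁ and C₂ be two distinct 2-directed blocks of G. Then |C₁ ∩ C₂| ≤ 1, i.e., C₁ and C₂ have at most one vertex in common. -/
variable {V : Type*}

theorem rtg_mono_s2 {r s : V → V → Prop} {x y : V} (h : Relation.ReflTransGen r x y)
    (hrs : ∀ a b, r a b → s a b) : Relation.ReflTransGen s x y := by
  induction h with
  | refl => exact .refl
  | tail _ h ih => exact ih.tail (hrs _ _ h)

theorem path_of_reach {F : V → V → Prop} {S : Set V} {x y : V}
    (h : Relation.ReflTransGen (fun a b => F a b ∧ b ∈ S) x y) (hx : x ∈ S) :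
    ∃ p, IsDipath F x y p ∧ ∀ z ∈ p, z ∈ S := by
  induction h using Relation.ReflTransGen.head_induction_on with
  | refl => exact ⟨[y], by simp [IsDipath, List.Chain'], by simpa using hx⟩
  | @head a b hab _ ih =>
    obtain ⟨p, ⟨hc, hh, hl, hn⟩, hS⟩ := ih hab.2
    by_cases ha : a ∈ p
    · obtain ⟨s, t, rfl⟩ := List.append_of_mem ha
      refine ⟨a :: t, ⟨?_, by simp, ?_, ?_⟩, ?_⟩
      · exact List.IsChain.right_of_append hc
      · simpa [List.getLast?_append] using hl
      · exact (List.nodup_append.1 hn).2.1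
      · intro z hz; exact hS z (by simp only [List.mem_append]; exact Or.inr hz)
    · refine ⟨a :: p, ⟨?_, by simp, ?_, ?_⟩, ?_⟩
      · cases p with
        | nil => simp at hh
        | cons c p =>
          simp at hh; subst hh
          exact List.isChain_cons_cons.2 ⟨hab.1, hc⟩
      · cases p with
        | nil => simp at hh
        | cons c p => simpa [List.getLast?_cons_cons] using hl
      · exact List.nodup_cons.2 ⟨ha, hn⟩
      · intro z hz
        rcases List.mem_cons.1 hz with rfl | hz
        · exact hx
        · exact hS z hz

theorem reach_of_path {E : V → V → Prop} {w y : V} (p : List V) : ∀ {x : V},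
    List.IsChain E p → p.head? = some x → p.getLast? = some y → w ∉ p →
    Relation.ReflTransGen (DelVertex E w) x y := by
  induction p with
  | nil => intro x _ h; simp at h
  | cons a p ih =>
    intro x hc hh hl hw
    simp at hh; subst hh
    cases p with
    | nil => simp at hl; subst hl; exact .refl
    | cons b p =>
      rw [List.isChain_cons_cons] at hc
      simp only [List.mem_cons, not_or] at hw
      refine .head ⟨hc.1, Ne.symm hw.1, Ne.symm hw.2.1⟩ (ih hc.2 (by simp) ?_ ?_)
      · simpa [List.getLast?_cons_cons] using hl
      · simp [hw]

theorem TwoVDP.avoid {E : V → V → Prop} {x y w : V} (h : TwoVDP E x y) (h1 : w ≠ x)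
    (h2 : w ≠ y) : Relation.ReflTransGen (DelVertex E w) x y := by
  obtain ⟨p, q, hp, hq, -, hd⟩ := h
  by_cases hw : w ∈ p
  · have : w ∉ q := fun hw' => by rcases hd w hw hw' with h | h <;> contradiction
    exact reach_of_path q hq.1 hq.2.1 hq.2.2.1 this
  · exact reach_of_path p hp.1 hp.2.1 hp.2.2.1 hw

structure MW (E : V → V → Prop) (x y : V) (A B : Set V) (v : V) (r : List V) : Prop where
  xA : x ∈ A
  xB : x ∈ B
  tA : ∀ u ∈ A, Relation.ReflTransGen (fun a b => E a b ∧ b ∈ A) x u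
  tB : ∀ u ∈ B, Relation.ReflTransGen (fun a b => E a b ∧ b ∈ B) x u
  inter : ∀ z ∈ A, z ∈ B → z = x
  inB : ∃ u ∈ B, E u v
  dA : ∀ z ∈ v :: r, z ∉ A
  dB : ∀ z ∈ v :: r, z ∉ B
  ch : List.IsChain E (v :: r)
  last : (v :: r).getLast? = some y
  nd : (v :: r).Nodup

theorem tree_insert {E : V → V → Prop} {x v : V} {B : Set V}
    (tB : ∀ u ∈ B, Relation.ReflTransGen (fun a b => E a b ∧ b ∈ B) x u)
    (h : ∃ u ∈ B, E u v) : ∀ u ∈ insert v B,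
    Relation.ReflTransGen (fun a b => E a b ∧ b ∈ insert v B) x u := by
  have key : ∀ u ∈ B, Relation.ReflTransGen (fun a b => E a b ∧ b ∈ insert v B) x u :=
    fun u hu => rtg_mono_s2 (tB u hu) fun a b hab => ⟨hab.1, Or.inr hab.2⟩
  rintro u (rfl | hu)
  · obtain ⟨t, ht, hE⟩ := h
    exact (key t ht).tail ⟨hE, Or.inl rfl⟩
  · exact key u hu

theorem MW.step {E : V → V → Prop} {x y : V} {A B : Set V} {v w : V} {r : List V}
    (h : MW E x y A B v (w :: r)) : MW E x y A (insert v B) w r where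
  xA := h.xA
  xB := Or.inr h.xB
  tA := h.tA
  tB := tree_insert h.tB h.inB
  inter := by
    rintro z hz (rfl | hz')
    · exact absurd hz (h.dA z (by simp))
    · exact h.inter z hz hz'
  inB := ⟨v, Or.inl rfl, (List.isChain_cons_cons.1 h.ch).1⟩
  dA := fun z hz => h.dA z (List.mem_cons_of_mem _ hz)
  dB := by
    rintro z hz (rfl | hz')
    · exact (List.nodup_cons.1 h.nd).1 hz
    · exact h.dB z (List.mem_cons_of_mem _ hz) hz'
  ch := (List.isChain_cons_cons.1 h.ch).2
  last := by simpa [List.getLast?_cons_cons] using h.last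
  nd := (List.nodup_cons.1 h.nd).2

theorem MW.swap {E : V → V → Prop} {x y : V} {A B : Set V} {v : V} {r : List V}
    (h : MW E x y A B v r) (hA : ∃ u ∈ A, E u v) : MW E x y B A v r :=
  ⟨h.xB, h.xA, h.tB, h.tA, fun z a b => h.inter z b a, hA, h.dB, h.dA, h.ch, h.last, h.nd⟩

theorem MW.adv {E : V → V → Prop} {x y z p : V} {A : Set V} (hz : z ∈ A) (hE : E z p)
    (r : List V) : ∀ {B : Set V} {v : V}, MW E x y A B v r → p ∈ v :: r →
    ∃ B' v' r', MW E x y A B' v' r' ∧ (∃ u ∈ A, E u v') ∧ r'.length ≤ r.length := by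
  induction r with
  | nil =>
    intro B v h hp
    simp at hp; subst hp
    exact ⟨B, p, [], h, ⟨z, hz, hE⟩, le_rfl⟩
  | cons w r ih =>
    intro B v h hp
    rcases List.mem_cons.1 hp with rfl | hp
    · exact ⟨B, p, _, h, ⟨z, hz, hE⟩, le_rfl⟩
    · obtain ⟨B', v', r', h1, h2, h3⟩ := ih h.step hp
      exact ⟨B', v', r', h1, h2, h3.trans (by simp)⟩

theorem MW.growA {E : V → V → Prop} {x y z : V} {A B : Set V} {v : V} {r : List V}
    (h : MW E x y A B v r) (hz : ∃ u ∈ A, E u z) (h1 : z ∉ v :: r) (h2 : z ∉ B) :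
    MW E x y (insert z A) B v r where
  xA := Or.inr h.xA
  xB := h.xB
  tA := tree_insert h.tA hz
  tB := h.tB
  inter := by
    rintro t (rfl | ht) ht'
    · contradiction
    · exact h.inter t ht ht'
  inB := h.inB
  dA := by
    rintro t ht (rfl | ht')
    · contradiction
    · exact h.dA t ht ht'
  dB := h.dB
  ch := h.ch
  last := h.last
  nd := h.nd

theorem MW.grow {E : V → V → Prop} {x y z : V} {v : V} {r : List V}
    (hR : Relation.ReflTransGen (DelVertex E v) z y) : ∀ {A B : Set V},
    MW E x y A B v r → (∃ u ∈ A, E u v) → z ∈ A →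
    ∃ A' B' v' r', MW E x y A' B' v' r' ∧ (∃ u ∈ A', E u v') ∧ r'.length < r.length := by
  induction hR using Relation.ReflTransGen.head_induction_on with
  | refl =>
    intro A B h _ hz
    exact absurd hz (h.dA _ (List.mem_of_getLast? h.last))
  | @head z z' hzz _ ih =>
    intro A B h hA hz
    by_cases h1 : z' ∈ A
    · exact ih h hA h1
    by_cases h2 : z' ∈ B
    · exact ih (h.swap hA) h.inB h2
    by_cases h3 : z' ∈ r
    · cases r with
      | nil => simp at h3
      | cons w r =>
        obtain ⟨B', v', r', a, b, c⟩ := MW.adv hz hzz.1 r h.step h3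
        exact ⟨A, B', v', r', a, b, by simp; omega⟩
    · have h4 : z' ∉ v :: r := by simp [h3, hzz.2.2]
      obtain ⟨u, hu, hE⟩ := hA
      exact ih (h.growA ⟨z, hz, hzz.1⟩ h4 h2) ⟨u, Or.inr hu, hE⟩ (Or.inl rfl)

theorem MW.final {E : V → V → Prop} {x y : V}
    (hR : ∀ w, w ≠ x → w ≠ y → Relation.ReflTransGen (DelVertex E w) x y) (n : ℕ) :
    ∀ {A B : Set V} {v : V} {r : List V}, r.length = n →
    MW E x y A B v r → (∃ u ∈ A, E u v) →
    ∃ A' B' r', MW E x y A' B' y r' ∧ (∃ u ∈ A', E u y) := by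
  induction n using Nat.strong_induction_on with
  | _ n ih =>
    intro A B v r hn h hA
    by_cases hv : v = y
    · subst hv; exact ⟨A, B, r, h, hA⟩
    have hvx : v ≠ x := by
      rintro rfl
      exact h.dA v (by simp) h.xA
    obtain ⟨A', B', v', r', a, b, c⟩ := MW.grow (hR v hvx hv) h hA h.xA
    exact ih _ (hn ▸ c) rfl a b

theorem menger_two_s2 {E : V → V → Prop} {x y : V} (hxy : x ≠ y) (hE : ¬ E x y)
    (h0 : Relation.ReflTransGen E x y)
    (hR : ∀ w, w ≠ x → w ≠ y → Relation.ReflTransGen (DelVertex E w) x y) :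
    TwoVDP E x y := by
  obtain ⟨P, ⟨hc, hh, hl, hn⟩, -⟩ := path_of_reach (F := E) (S := Set.univ)
    (rtg_mono_s2 h0 fun a b hab => ⟨hab, trivial⟩) trivial
  rcases P with _ | ⟨a, _ | ⟨v, r⟩⟩
  · simp at hh
  · simp at hh hl; exact absurd (hh.symm.trans hl) hxy
  simp at hh; subst hh
  have hc' := List.isChain_cons_cons.1 hc
  have hn' := List.nodup_cons.1 hn
  have hd : ∀ z ∈ v :: r, z ∉ ({a} : Set V) := by
    rintro z hz rfl; exact hn'.1 hz
  have ht : ∀ u ∈ ({a} : Set V),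
      Relation.ReflTransGen (fun s t => E s t ∧ t ∈ ({a} : Set V)) a u := by
    rintro u rfl; exact .refl
  have h : MW E a y {a} {a} v r :=
    ⟨rfl, rfl, ht, ht, fun z hz _ => hz, ⟨a, rfl, hc'.1⟩, hd, hd, hc'.2,
      by simpa [List.getLast?_cons_cons] using hl, hn'.2⟩
  obtain ⟨A, B, r', hW, hA⟩ := MW.final hR _ rfl h ⟨a, rfl, hc'.1⟩
  obtain ⟨p, hp, hpA⟩ := path_of_reach (tree_insert hW.tA hA y (Or.inl rfl)) (Or.inr hW.xA)
  obtain ⟨q, hq, hqB⟩ := path_of_reach (tree_insert hW.tB hW.inB y (Or.inl rfl)) (Or.inr hW.xB)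
  have hdis : ∀ z, z ∈ p → z ∈ q → z = a ∨ z = y := by
    intro z hzp hzq
    rcases hpA z hzp with h | h
    · exact Or.inr h
    rcases hqB z hzq with h' | h'
    · exact Or.inr h'
    exact Or.inl (hW.inter z h h')
  refine ⟨p, q, hp, hq, ?_, hdis⟩
  rintro rfl
  clear hc hl hn hc' hn'
  obtain ⟨hc, hh, hl, hn⟩ := hp
  rcases p with _ | ⟨b, _ | ⟨c, s⟩⟩
  · simp at hh
  · simp at hh hl; exact hxy (hh.symm.trans hl)
  simp at hh; subst hh
  have h1 := (List.isChain_cons_cons.1 hc).1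
  rcases hdis c (by simp) (by simp) with rfl | rfl
  · simp at hn
  · exact hE h1

theorem two_trans {E : V → V → Prop} {x y a b : V} (hxy : x ≠ y) (hab : a ≠ b)
    (hxa : x ≠ a) (hxb : x ≠ b) (hya : y ≠ a) (hyb : y ≠ b)
    (h1 : TwoVDP E x a) (h2 : TwoVDP E x b) (h3 : TwoVDP E a y) (h4 : TwoVDP E b y) :
    TwoVDP E x y := by
  have e1 := h1.avoid hxy.symm hya
  have e2 := h3.avoid hxa hxy
  by_cases hE : E x y
  · have k1 : Relation.ReflTransGen (fun s t => (E s t ∧ ¬ (s = x ∧ t = y)) ∧ t ∈ Set.univ) x a :=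
      rtg_mono_s2 e1 fun s t h => ⟨⟨h.1, fun h' => h.2.2 h'.2⟩, trivial⟩
    have k2 : Relation.ReflTransGen (fun s t => (E s t ∧ ¬ (s = x ∧ t = y)) ∧ t ∈ Set.univ) a y :=
      rtg_mono_s2 e2 fun s t h => ⟨⟨h.1, fun h' => h.2.1 h'.1⟩, trivial⟩
    obtain ⟨p, ⟨hc, hh, hl, hn⟩, -⟩ :=
      path_of_reach (F := fun s t => E s t ∧ ¬ (s = x ∧ t = y)) (k1.trans k2) trivial
    refine ⟨p, [x, y], ⟨List.IsChain.imp (fun _ _ h => h.1) hc, hh, hl, hn⟩,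
      ⟨?_, by simp, by simp, by simp [hxy]⟩, ?_, ?_⟩
    · exact List.isChain_cons_cons.2 ⟨hE, by simp⟩
    · rintro rfl
      exact (List.isChain_cons_cons.1 hc).1.2 ⟨rfl, rfl⟩
    · intro z _ hz; simpa using hz
  · refine menger_two_s2 hxy hE ?_ ?_
    · exact Relation.ReflTransGen.trans (rtg_mono_s2 e1 fun s t h => h.1) (rtg_mono_s2 e2 fun s t h => h.1)
    · intro w hwx hwy
      by_cases hwa : w = a
      · have hwb : w ≠ b := hwa ▸ hab
        exact (h2.avoid hwx hwb).trans (h4.avoid hwb hwy)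
      · exact (h1.avoid hwx hwa).trans (h3.avoid hwa hwy)

/-- Lemma 3: two distinct 2-directed blocks intersect in at most one
vertex. -/
theorem stmt2 {V : Type*} [Fintype V] (E : V → V → Prop)
    (hirr : ∀ v, ¬ E v v) (hsc : IsStronglyConn E) (C₁ C₂ : Set V)
    (h₁ : IsMaxBlock (Rel2d E) 2 C₁) (h₂ : IsMaxBlock (Rel2d E) 2 C₂)
    (hne : C₁ ≠ C₂) : (C₁ ∩ C₂).ncard ≤ 1 := by
  by_contra hcon
  push Not at hcon
  obtain ⟨a, b, ha, hb, hab⟩ := (Set.one_lt_ncard_iff (Set.toFinite _)).1 hcon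
  obtain ⟨-, r1, m1⟩ := h₁
  obtain ⟨-, r2, m2⟩ := h₂
  have key : ∀ x ∈ C₁, ∀ y ∈ C₂, x ≠ y → Rel2d E x y := by
    intro x hx y hy hxy
    by_cases hxa : x = a
    · exact r2 x (hxa ▸ ha.2) y hy hxy
    by_cases hxb : x = b
    · exact r2 x (hxb ▸ hb.2) y hy hxy
    by_cases hya : y = a
    · exact r1 x hx y (hya ▸ ha.1) hxy
    by_cases hyb : y = b
    · exact r1 x hx y (hyb ▸ hb.1) hxy
    have xa := r1 x hx a ha.1 hxa
    have xb := r1 x hx b hb.1 hxb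
    have ya := r2 y hy a ha.2 hya
    have yb := r2 y hy b hb.2 hyb
    exact ⟨hxy, two_trans hxy hab hxa hxb hya hyb xa.2.1 xb.2.1 ya.2.2 yb.2.2,
      two_trans hxy.symm hab hya hyb hxa hxb ya.2.1 yb.2.1 xa.2.2 xb.2.2⟩
  have hU : ∀ x ∈ C₁ ∪ C₂, ∀ y ∈ C₁ ∪ C₂, x ≠ y → Rel2d E x y := by
    rintro x (hx | hx) y (hy | hy) hxy
    · exact r1 x hx y hy hxy
    · exact key x hx y hy hxy
    · have := key y hy x hx hxy.symm
      exact ⟨hxy, this.2.2, this.2.1⟩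
    · exact r2 x hx y hy hxy
  exact hne ((m1 _ Set.subset_union_left hU).symm.trans (m2 _ Set.subset_union_right hU))
end

section
/- Let G = (V,E) be a strongly connected finite simple directed graph and let G* = (V, E*) be the undirected graph on V whose edges are exactly the unordered pairs {x, y} of distinct vertices with x ↔² y. Then G* is a chordal graph, i.e., every cycle of G* of length at least 4 has a chord. -/
variable {V : Type*}

namespace ChordalAux

open Relation

/-- Every vertex of `X` is reachable from `x` inside `X`. -/
def Rooted (E : V → V → Prop) (x : V) (X : Set V) : Prop :=
  x ∈ X ∧ ∀ v ∈ X, ReflTransGen (fun a b => E a b ∧ b ∈ X) x v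

lemma reach_mono {E : V → V → Prop} {X Y : Set V} (h : X ⊆ Y) {x v : V}
    (hr : ReflTransGen (fun a b => E a b ∧ b ∈ X) x v) :
    ReflTransGen (fun a b => E a b ∧ b ∈ Y) x v :=
  ReflTransGen.mono (fun _ _ hab => ⟨hab.1, h hab.2⟩) _ _ hr

lemma Rooted.ins {E : V → V → Prop} {x : V} {X : Set V} (h : Rooted E x X) {u w : V}
    (hu : u ∈ X) (huw : E u w) : Rooted E x (insert w X) := by
  refine ⟨Or.inr h.1, ?_⟩
  have hsub : X ⊆ Insert.insert w X := Set.subset_insert _ _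
  rintro v (rfl | hv)
  · exact (reach_mono hsub (h.2 u hu)).tail ⟨huw, Or.inl rfl⟩
  · exact reach_mono hsub (h.2 v hv)

/-- Extend a rooted set along a path. -/
lemma Rooted.extend {E : V → V → Prop} {x t : V} {T : List V} (M : List V) :
    ∀ (X : Set V) (b u : V), Rooted E x X → u ∈ X → E u b → List.IsChain E (b :: (M ++ t :: T)) →
    Rooted E x (X ∪ {z | z ∈ b :: M}) ∧ ∃ u ∈ X ∪ {z | z ∈ b :: M}, E u t := by
  induction M with
  | nil =>
    intro X b u hX hu hub hc
    have h1 := hX.ins hu hub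
    have : X ∪ {z | z ∈ [b]} = insert b X := by ext z; simp
    rw [this]
    simp at hc
    exact ⟨h1, b, Or.inl rfl, hc.1⟩
  | cons m M ih =>
    intro X b u hX hu hub hc
    have h1 := hX.ins hu hub
    have : X ∪ {z | z ∈ b :: m :: M} = insert b X ∪ {z | z ∈ m :: M} := by
      ext z; simp; tauto
    rw [this]
    rw [List.cons_append, List.isChain_cons_cons] at hc
    exact ih _ m b h1 (Or.inl rfl) hc.1 hc.2

/-- From reachability to a simple path. -/
lemma exists_dipath {E : V → V → Prop} {S : Set V} {x y : V}
    (h : ReflTransGen (fun a b => E a b ∧ b ∈ S) x y) :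
    ∃ p, IsDipath E x y p ∧ ∀ z ∈ p, z = x ∨ z ∈ S := by
  induction h using ReflTransGen.head_induction_on with
  | refl => exact ⟨[y], ⟨List.isChain_singleton y, rfl, rfl, by simp⟩, by simp⟩
  | @head a c hac _ ih =>
    obtain ⟨p, ⟨hch, hhd, hlast, hnd⟩, hS⟩ := ih
    have hS' : ∀ z ∈ p, z ∈ S := fun z hz => (hS z hz).elim (fun h => h ▸ hac.2) id
    by_cases ha : a ∈ p
    · obtain ⟨l1, l2, rfl⟩ := List.append_of_mem ha
      refine ⟨a :: l2, ⟨List.IsChain.right_of_append hch, rfl, ?_, (List.nodup_append.1 hnd).2.1⟩, ?_⟩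
      · simpa [List.getLast?_append] using hlast
      · intro z hz
        exact Or.inr (hS' z (List.mem_append_right _ hz))
    · refine ⟨a :: p, ⟨?_, rfl, ?_, List.nodup_cons.2 ⟨ha, hnd⟩⟩, ?_⟩
      · refine List.IsChain.cons hch ?_
        intro z hz
        rw [hhd] at hz
        simp at hz
        exact hz ▸ hac.1
      · cases p with
        | nil => simp at hhd
        | cons d p => simpa [List.getLast?_cons_cons] using hlast
      · intro z hz
        rcases List.mem_cons.1 hz with h | h
        · exact Or.inl h
        · exact Or.inr (hS' z h)

lemma reach_of_chain {R : V → V → Prop} (p : List V) : ∀ {x y : V}, List.IsChain R p →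
    p.head? = some x → p.getLast? = some y → ReflTransGen R x y := by
  induction p with
  | nil => intro x y _ h; simp at h
  | cons a p ih =>
    intro x y hc hh hl
    simp at hh
    subst hh
    cases p with
    | nil => simp at hl; subst hl; exact .refl
    | cons b p =>
      rw [List.isChain_cons_cons] at hc
      refine ReflTransGen.head hc.1 (ih hc.2 rfl ?_)
      simpa [List.getLast?_cons_cons] using hl

/-- Search lemma: grow the two rooted sets until the tail `T` is hit. -/
lemma search {E : V → V → Prop} {x b : V} {C : Set V} {A B : Set V}
    (hA : Rooted E x A) (hB : Rooted E x B) (hAB : ∀ z ∈ A, z ∈ B → z = x)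
    (hC : ∀ z ∈ C, z ∉ A ∧ z ∉ B) {y : V} (hr : ReflTransGen (DelVertex E b) x y) :
    ∃ A' B', A ⊆ A' ∧ B ⊆ B' ∧ Rooted E x A' ∧ Rooted E x B' ∧ (∀ z ∈ A', z ∈ B' → z = x) ∧
      (∀ z ∈ C, z ∉ A' ∧ z ∉ B') ∧
      ((∃ t ∈ C, t ≠ b ∧ ∃ v, (v ∈ A' ∨ v ∈ B') ∧ E v t) ∨ (y ∈ A' ∨ y ∈ B')) := by
  induction hr with
  | refl => exact ⟨A, B, subset_rfl, subset_rfl, hA, hB, hAB, hC, Or.inr (Or.inl hA.1)⟩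
  | @tail v w _ hvw ih =>
    obtain ⟨A', B', h1, h2, h3, h4, h5, h6, h7⟩ := ih
    rcases h7 with h7 | h7
    · exact ⟨A', B', h1, h2, h3, h4, h5, h6, Or.inl h7⟩
    by_cases hw : w ∈ A' ∨ w ∈ B'
    · exact ⟨A', B', h1, h2, h3, h4, h5, h6, Or.inr hw⟩
    by_cases hwC : w ∈ C
    · exact ⟨A', B', h1, h2, h3, h4, h5, h6, Or.inl ⟨w, hwC, hvw.2.2, v, h7, hvw.1⟩⟩
    push Not at hw
    rcases h7 with h7 | h7
    · refine ⟨insert w A', B', h1.trans (Set.subset_insert _ _), h2, h3.ins h7 hvw.1, h4, ?_, ?_,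
        Or.inr (Or.inl (Or.inl rfl))⟩
      · rintro z (rfl | hz) hz'
        · exact absurd hz' hw.2
        · exact h5 z hz hz'
      · intro z hz
        refine ⟨?_, (h6 z hz).2⟩
        rintro (rfl | h)
        · exact hwC hz
        · exact (h6 z hz).1 h
    · refine ⟨A', insert w B', h1, h2.trans (Set.subset_insert _ _), h3, h4.ins h7 hvw.1, ?_, ?_,
        Or.inr (Or.inr (Or.inl rfl))⟩
      · rintro z hz' (rfl | hz)
        · exact absurd hz' hw.1
        · exact h5 z hz' hz
      · intro z hz
        refine ⟨(h6 z hz).1, ?_⟩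
        rintro (rfl | h)
        · exact hwC hz
        · exact (h6 z hz).2 h

lemma core {E : V → V → Prop} {x y : V}
    (hv : ∀ w, w ≠ x → w ≠ y → DiReach (DelVertex E w) x y) (n : ℕ) :
    ∀ (A B : Set V) (b : V) (T : List V), T.length ≤ n → Rooted E x A → Rooted E x B →
      (∀ z ∈ A, z ∈ B → z = x) → List.IsChain E (b :: T) → (b :: T).getLast? = some y →
      (b :: T).Nodup → (∀ z ∈ b :: T, z ∉ A ∧ z ∉ B) → (∃ u ∈ A, E u b) → (∃ u ∈ B, E u b) →
      ∃ A B : Set V, Rooted E x A ∧ Rooted E x B ∧ (∀ z ∈ A, z ∈ B → z = x) ∧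
        (∃ u ∈ A, E u y) ∧ (∃ u ∈ B, E u y) := by
  induction n with
  | zero =>
    intro A B b T hT hA hB hAB hc hl hnd hd hu hw
    have : T = [] := List.length_eq_zero_iff.1 (by omega)
    subst this
    simp at hl
    subst hl
    exact ⟨A, B, hA, hB, hAB, hu, hw⟩
  | succ n ih =>
    intro A B b T hT hA hB hAB hc hl hnd hd hu hw
    by_cases hby : b = y
    · subst hby
      exact ⟨A, B, hA, hB, hAB, hu, hw⟩
    have hbx : b ≠ x := by
      rintro rfl
      exact (hd b (by simp)).1 hA.1
    have hyT : y ∈ b :: T := List.mem_of_getLast? hl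
    obtain ⟨A', B', h1, h2, h3, h4, h5, h6, h7⟩ :=
      search (C := {z | z ∈ b :: T}) hA hB hAB hd (hv b hbx hby)
    have h7 : ∃ t ∈ b :: T, t ≠ b ∧ ∃ v, (v ∈ A' ∨ v ∈ B') ∧ E v t := by
      rcases h7 with h7 | h7 | h7
      · exact h7
      · exact absurd h7 (h6 y hyT).1
      · exact absurd h7 (h6 y hyT).2
    obtain ⟨t, ht, htb, v, hvAB, hvt⟩ := h7
    have htT : t ∈ T := by simpa [htb] using ht
    obtain ⟨M, T', rfl⟩ := List.append_of_mem htT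
    have key : ∀ A B : Set V, Rooted E x A → Rooted E x B → (∀ z ∈ A, z ∈ B → z = x) →
        (∀ z ∈ b :: (M ++ t :: T'), z ∉ A ∧ z ∉ B) → (∃ u ∈ B, E u b) → v ∈ A →
        ∃ A B : Set V, Rooted E x A ∧ Rooted E x B ∧ (∀ z ∈ A, z ∈ B → z = x) ∧
        (∃ u ∈ A, E u y) ∧ (∃ u ∈ B, E u y) := by
      intro A B hA hB hAB hd ⟨u, huB, hub⟩ hvA
      obtain ⟨g1, g2⟩ := Rooted.extend M B b u hB huB hub hc
      have hsplit : b :: (M ++ t :: T') = (b :: M) ++ (t :: T') := by simp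
      rw [hsplit] at hc hl hnd hd
      refine ih A (B ∪ {z | z ∈ b :: M}) t T' ?_ hA g1 ?_ (List.IsChain.right_of_append hc) ?_
        (List.nodup_append.1 hnd).2.1 ?_ ⟨v, hvA, hvt⟩ g2
      · simp at hT; omega
      · rintro z hz (hz' | hz')
        · exact hAB z hz hz'
        · exact absurd hz (hd z (List.mem_append_left _ hz')).1
      · rw [List.getLast?_append] at hl
        simpa using hl
      · intro z hz
        have := hd z (List.mem_append_right _ hz)
        refine ⟨this.1, ?_⟩
        rintro (h | h)
        · exact this.2 h
        · exact (List.nodup_append.1 hnd).2.2 z h z hz rfl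
    rcases hvAB with h | h
    · exact key A' B' h3 h4 h5 h6 (hw.imp fun u hu => ⟨h2 hu.1, hu.2⟩) h
    · exact key B' A' h4 h3 (fun z hz hz' => h5 z hz' hz) (fun z hz => (h6 z hz).symm)
        (hu.imp fun u hu => ⟨h1 hu.1, hu.2⟩) h

/-- Menger's theorem for two paths. -/
lemma menger {E : V → V → Prop} {x y : V} (hxy : x ≠ y) (hE : ¬ E x y) (hr : DiReach E x y)
    (hv : ∀ w, w ≠ x → w ≠ y → DiReach (DelVertex E w) x y) : TwoVDP E x y := by
  have hr' : ReflTransGen (fun a b => E a b ∧ b ∈ (Set.univ : Set V)) x y :=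
    ReflTransGen.mono (fun a b h => ⟨h, trivial⟩) _ _ hr
  obtain ⟨p, ⟨hch, hhd, hlast, hnd⟩, -⟩ := exists_dipath hr'
  obtain ⟨b, T, rfl⟩ : ∃ b T, p = x :: b :: T := by
    match p, hhd, hlast with
    | [a], h1, h2 => simp at h1 h2; exact absurd (h1.symm.trans h2) hxy
    | a :: b :: T, h1, _ => simp at h1; exact ⟨b, T, by rw [h1]⟩
  have hc : List.IsChain E (x :: b :: T) := hch
  rw [List.isChain_cons_cons] at hc
  have hroot : Rooted E x {x} := ⟨rfl, by rintro v rfl; exact .refl⟩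
  have hxT := (List.nodup_cons.1 hnd).1
  have hd : ∀ z ∈ b :: T, z ∉ ({x} : Set V) := by
    rintro z hz rfl
    exact hxT hz
  obtain ⟨A, B, hA, hB, hAB, ⟨u, huA, hu⟩, ⟨w, hwB, hw⟩⟩ := core hv T.length {x} {x} b T le_rfl hroot
    hroot (fun z hz _ => hz) hc.2 (by simpa [List.getLast?_cons_cons] using hlast)
    (List.nodup_cons.1 hnd).2 (fun z hz => ⟨hd z hz, hd z hz⟩) ⟨x, rfl, hc.1⟩ ⟨x, rfl, hc.1⟩
  have hA' := hA.ins huA hu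
  have hB' := hB.ins hwB hw
  obtain ⟨p, hp, hpA⟩ := exists_dipath (hA'.2 y (Or.inl rfl))
  obtain ⟨q, hq, hqB⟩ := exists_dipath (hB'.2 y (Or.inl rfl))
  have hint : ∀ z, z ∈ p → z ∈ q → z = x ∨ z = y := by
    intro z hz hz'
    rcases hpA z hz with h | h | h
    · exact Or.inl h
    · exact Or.inr h
    rcases hqB z hz' with h' | h' | h'
    · exact Or.inl h'
    · exact Or.inr h'
    exact Or.inl (hAB z h h')
  refine ⟨p, q, hp, hq, ?_, hint⟩
  rintro rfl
  have hint : ∀ z ∈ p, z = x ∨ z = y := fun z hz => hint z hz hz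
  obtain ⟨c1, c2, c3, c4⟩ := hp
  match p, c1, c2, c3, c4, hint with
  | [a], _, h1, h2, _, _ => simp at h1 h2; exact hxy (h1.symm.trans h2)
  | a :: b :: T, c1, h1, _, c4, hint =>
    simp at h1
    subst h1
    have c1 : List.IsChain E (a :: b :: T) := c1
    rw [List.isChain_cons_cons] at c1
    rcases hint b (by simp) with h | h
    · subst h; simp at c4
    · subst h; exact hE c1.1

/-- Deleting an edge. -/
def DelEdge (E : V → V → Prop) (x y : V) : V → V → Prop :=
  fun a b => E a b ∧ ¬ (a = x ∧ b = y)

lemma two_of {E : V → V → Prop} {x y : V} (hxy : x ≠ y) (hr : DiReach (DelEdge E x y) x y)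
    (hv : ∀ w, w ≠ x → w ≠ y → DiReach (DelVertex E w) x y) : TwoVDP E x y := by
  by_cases hE : E x y
  · have hr' : ReflTransGen (fun a b => DelEdge E x y a b ∧ b ∈ (Set.univ : Set V)) x y :=
      ReflTransGen.mono (fun a b h => ⟨h, trivial⟩) _ _ hr
    obtain ⟨p, ⟨hch, hhd, hlast, hnd⟩, -⟩ := exists_dipath hr'
    have hch : List.IsChain (DelEdge E x y) p := hch
    refine ⟨p, [x, y], ⟨hch.imp fun _ _ h => h.1, hhd, hlast, hnd⟩,
      ⟨List.isChain_pair.2 hE, rfl, rfl, by simpa using hxy⟩, ?_, ?_⟩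
    · rintro rfl
      rw [List.isChain_pair] at hch
      exact hch.2 ⟨rfl, rfl⟩
    · intro z _ hz
      simpa using hz
  · exact menger hxy hE (ReflTransGen.mono (fun _ _ h => h.1) _ _ hr) hv

lemma del_vertex_of {E : V → V → Prop} {a b w : V} (h : TwoVDP E a b) (ha : w ≠ a) (hb : w ≠ b) :
    DiReach (DelVertex E w) a b := by
  obtain ⟨p, q, hp, hq, -, hpq⟩ := h
  have key : ∀ p, IsDipath E a b p → w ∉ p → DiReach (DelVertex E w) a b := by
    intro p ⟨h1, h2, h3, _⟩ hw
    have h1 : List.IsChain E p := h1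
    refine reach_of_chain p (h1.imp_of_mem_imp ?_) h2 h3
    intro c d hc hd hcd
    exact ⟨hcd, fun h => hw (h ▸ hc), fun h => hw (h ▸ hd)⟩
  by_cases hwp : w ∈ p
  · refine key q hq fun hwq => ?_
    rcases hpq w hwp hwq with h | h
    · exact ha h
    · exact hb h
  · exact key p hp hwp

lemma del_edge_of {E : V → V → Prop} {a b x y : V} (h : TwoVDP E a b) (hxy : x ≠ y)
    (hne : s(a, b) ≠ s(x, y)) : DiReach (DelEdge E x y) a b := by
  obtain ⟨p, q, hp, hq, -, hpq⟩ := h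
  have key : ∀ p, IsDipath E a b p → ¬ (x ∈ p ∧ y ∈ p) → DiReach (DelEdge E x y) a b := by
    intro p ⟨h1, h2, h3, _⟩ hw
    have h1 : List.IsChain E p := h1
    refine reach_of_chain p (h1.imp_of_mem_imp ?_) h2 h3
    intro c d hc hd hcd
    exact ⟨hcd, fun h => hw ⟨h.1 ▸ hc, h.2 ▸ hd⟩⟩
  by_cases hwp : x ∈ p ∧ y ∈ p
  · refine key q hq fun hwq => hne ?_
    rcases hpq x hwp.1 hwq.1 with h | h <;> rcases hpq y hwp.2 hwq.2 with h' | h'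
    · exact absurd (h.trans h'.symm) hxy
    · rw [h, h']
    · rw [h, h', Sym2.eq_swap]
    · exact absurd (h.trans h'.symm) hxy
  · exact key p hp hwp

lemma scc_trans {E : V → V → Prop} {a b c : V} (h : InSameSCC E a b) (h' : InSameSCC E b c) :
    InSameSCC E a c := ⟨ReflTransGen.trans h.1 h'.1, ReflTransGen.trans h'.2 h.2⟩

end ChordalAux

open ChordalAux

/-- the undirected graph `G*` whose edges are exactly the pairs `{x,y}`
with `x ↔² y` is chordal: every cycle of length at least 4 has a chord, i.e. an edge of
`G*` joining two vertices of the cycle that is not an edge of the cycle. -/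
theorem stmt5 {V : Type*} [Fintype V] (E : V → V → Prop)
    (hirr : ∀ v, ¬ E v v) (hsc : IsStronglyConn E)
    (Gs : SimpleGraph V) (hGs : ∀ x y, Gs.Adj x y ↔ Rel2d E x y)
    (v : V) (c : Gs.Walk v v) (hc : c.IsCycle) (hlen : 4 ≤ c.length) :
    ∃ a b : V, a ∈ c.support ∧ b ∈ c.support ∧ Gs.Adj a b ∧ s(a, b) ∉ c.edges := by
  have hadj : ∀ i, i < c.length → Rel2d E (c.getVert i) (c.getVert (i + 1)) :=
    fun i hi => (hGs _ _).1 (c.adj_getVert_succ hi)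
  have hinj : ∀ i j, 1 ≤ i → i ≤ c.length → 1 ≤ j → j ≤ c.length →
      c.getVert i = c.getVert j → i = j :=
    fun i j h1 h2 h3 h4 h => hc.getVert_injOn ⟨h1, h2⟩ ⟨h3, h4⟩ h
  have h0 : c.getVert 0 = c.getVert c.length := by simp
  obtain ⟨x, hx⟩ : ∃ x, x = c.getVert 0 := ⟨_, rfl⟩
  obtain ⟨m, hm⟩ : ∃ x, x = c.getVert 1 := ⟨_, rfl⟩
  obtain ⟨y, hy⟩ : ∃ x, x = c.getVert 2 := ⟨_, rfl⟩
  have hxm : Rel2d E x m := by rw [hx, hm]; exact hadj 0 (by omega)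
  have hmy : Rel2d E m y := by rw [hm, hy]; exact hadj 1 (by omega)
  have hxy : x ≠ y := by
    intro h
    rw [hx, hy, h0] at h
    have := hinj _ _ (by omega) (by omega) (by omega) (by omega) h
    omega
  have hV : ∀ w, w ≠ x → w ≠ y → InSameSCC (DelVertex E w) x y := by
    intro w hwx hwy
    by_cases hwm : w = m
    · have : ∀ i, 2 ≤ i → i ≤ c.length → InSameSCC (DelVertex E w) y (c.getVert i) := by
        intro i hi
        induction i, hi using Nat.le_induction with
        | base => intro _; rw [← hy]; exact ⟨.refl, .refl⟩
        | succ i hi ih =>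
          intro hlt
          have hw : ∀ j, 2 ≤ j → j ≤ c.length → w ≠ c.getVert j := by
            intro j hj hj' h
            rw [hwm, hm] at h
            have := hinj _ _ (by omega) (by omega) (by omega) (by omega) h
            omega
          have hr := hadj i (by omega)
          have n1 := hw i hi (by omega)
          have n2 := hw (i + 1) (by omega) hlt
          exact scc_trans (ih (by omega)) ⟨del_vertex_of hr.2.1 n1 n2, del_vertex_of hr.2.2 n2 n1⟩
      have := this c.length (by omega) le_rfl
      rw [← h0, ← hx] at this
      exact ⟨this.2, this.1⟩
    · exact scc_trans ⟨del_vertex_of hxm.2.1 hwx hwm, del_vertex_of hxm.2.2 hwm hwx⟩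
        ⟨del_vertex_of hmy.2.1 hwm hwy, del_vertex_of hmy.2.2 hwy hwm⟩
  have hEd : ∀ a b, a ≠ b → s(a, b) = s(x, y) → InSameSCC (DelEdge E a b) x y := by
    intro a b hab he
    have e1 : s(x, m) ≠ s(a, b) := by
      rw [he]; intro h
      have := hmy.1; have := hxm.1
      simp at h; grind
    have e2 : s(m, y) ≠ s(a, b) := by
      rw [he]; intro h
      have := hmy.1; have := hxm.1
      simp at h; grind
    exact scc_trans
      ⟨del_edge_of hxm.2.1 hab e1, del_edge_of hxm.2.2 hab (by rwa [Sym2.eq_swap])⟩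
      ⟨del_edge_of hmy.2.1 hab e2, del_edge_of hmy.2.2 hab (by rwa [Sym2.eq_swap])⟩
  refine ⟨x, y, ?_, ?_, ?_, ?_⟩
  · rw [hx]; exact c.getVert_mem_support _
  · rw [hy]; exact c.getVert_mem_support _
  · rw [hGs]
    exact ⟨hxy, two_of hxy (hEd x y hxy rfl).1 fun w h1 h2 => (hV w h1 h2).1,
      two_of hxy.symm (hEd y x hxy.symm Sym2.eq_swap).2 fun w h1 h2 => (hV w h2 h1).2⟩
  · intro hmem
    rw [SimpleGraph.Walk.mk_mem_edges_iff_exists] at hmem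
    obtain ⟨i, hi, he⟩ := hmem
    rw [Sym2.eq_iff] at he
    have hxl : x = c.getVert c.length := hx.trans h0
    have hi1 : ∀ j, 1 ≤ j → j ≤ c.length → c.getVert j = x → j = c.length := fun j h1 h2 h =>
      hinj _ _ h1 h2 (by omega) le_rfl (h.trans hxl)
    have hi2 : ∀ j, 1 ≤ j → j ≤ c.length → c.getVert j = y → j = 2 := fun j h1 h2 h =>
      hinj _ _ h1 h2 (by omega) (by omega) (h.trans hy)
    rcases he with ⟨e1, e2⟩ | ⟨e1, e2⟩
    · have a2 := hi2 _ (by omega) (by omega) e2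
      have a1 := hi1 _ (by omega) (by omega) e1
      omega
    · have a2 := hi1 _ (by omega) (by omega) e2
      have a1 := hi2 _ (by omega) (by omega) e1
      omega
end

section
/- Let G = (V,E) be a strongly connected finite simple directed graph and let C₁ and C₂ be two distinct 2-strong blocks of G. Then |C₁ ∩ C₂| ≤ 1, i.e., C₁ and C₂ have at most one vertex in common. -/
variable {V : Type*}

/-- Two vertices sharing two common block neighbours are related. -/
theorem rel2s_glue {V : Type*} (E : V → V → Prop) (A B : Set V)
    (hA : ∀ x ∈ A, ∀ y ∈ A, x ≠ y → Rel2s E x y)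
    (hB : ∀ x ∈ B, ∀ y ∈ B, x ≠ y → Rel2s E x y)
    (a b : V) (ha : a ∈ A ∩ B) (hb : b ∈ A ∩ B) (hab : a ≠ b)
    (x y : V) (hx : x ∈ A) (hy : y ∈ B) (hxy : x ≠ y) : Rel2s E x y := by
  refine ⟨hxy, fun z hzx hzy => ?_⟩
  have scc : ∀ (S : Set V), (∀ x ∈ S, ∀ y ∈ S, x ≠ y → Rel2s E x y) →
      ∀ u ∈ S, ∀ v ∈ S, z ≠ u → z ≠ v → InSameSCC (DelVertex E z) u v := by
    intro S hS u hu v hv h1 h2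
    by_cases h : u = v
    · subst h
      exact ⟨Relation.ReflTransGen.refl, Relation.ReflTransGen.refl⟩
    · exact (hS u hu v hv h).2 z h1 h2
  have key : ∀ c ∈ A ∩ B, z ≠ c → InSameSCC (DelVertex E z) x y := by
    intro c hc hzc
    have h1 := scc A hA x hx c hc.1 hzx hzc
    have h2 := scc B hB c hc.2 y hy hzc hzy
    exact ⟨Relation.ReflTransGen.trans h1.1 h2.1, Relation.ReflTransGen.trans h2.2 h1.2⟩
  by_cases h : z = a
  · exact key b hb (fun h' => hab (h.symm.trans h'))
  · exact key a ha h

/-- Lemma 9: two distinct 2-strong blocks intersect in at most one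
vertex. -/
theorem stmt8 {V : Type*} [Fintype V] (E : V → V → Prop)
    (hirr : ∀ v, ¬ E v v) (hsc : IsStronglyConn E) (C₁ C₂ : Set V)
    (h₁ : IsMaxBlock (Rel2s E) 2 C₁) (h₂ : IsMaxBlock (Rel2s E) 2 C₂)
    (hne : C₁ ≠ C₂) : (C₁ ∩ C₂).ncard ≤ 1 := by
  by_contra hcon
  have hlt : 1 < (C₁ ∩ C₂).ncard := by omega
  obtain ⟨a, b, ha, hb, hab⟩ := (Set.one_lt_ncard_iff (Set.toFinite _)).1 hlt
  have hU : ∀ x ∈ C₁ ∪ C₂, ∀ y ∈ C₁ ∪ C₂, x ≠ y → Rel2s E x y := by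
    rintro x (hx | hx) y (hy | hy) hxy
    · exact h₁.2.1 x hx y hy hxy
    · exact rel2s_glue E C₁ C₂ h₁.2.1 h₂.2.1 a b ha hb hab x y hx hy hxy
    · exact rel2s_glue E C₂ C₁ h₂.2.1 h₁.2.1 a b ha.symm hb.symm hab x y hx hy hxy
    · exact h₂.2.1 x hx y hy hxy
  exact hne ((h₁.2.2 _ Set.subset_union_left hU).symm.trans
    (h₂.2.2 _ Set.subset_union_right hU))
end

section
/- Let G = (V,E) be a strongly connected finite simple directed graph and let v₀, v₁, …, v_l be distinct vertices of G such that v₀ ↔^{2s} v_l and v_{i−1} ↔^{2s} v_i for every i ∈ {1, 2, …, l}. Then all the vertices v₀, v₁, …, v_l lie in the same 2-strong block of G. -/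
variable {V : Type*}

theorem InSameSCC.symmAux {V : Type*} {E : V → V → Prop} {x y : V} (h : InSameSCC E x y) :
    InSameSCC E y x := ⟨h.2, h.1⟩

theorem InSameSCC.transAux {V : Type*} {E : V → V → Prop} {x y w : V} (h : InSameSCC E x y)
    (h' : InSameSCC E y w) : InSameSCC E x w :=
  ⟨Relation.ReflTransGen.trans h.1 h'.1, Relation.ReflTransGen.trans h'.2 h.2⟩

theorem seg_aux {V : Type*} (E : V → V → Prop) (l : ℕ) (v : Fin (l + 1) → V)
    (hchain : ∀ i : Fin l, Rel2s E (v i.castSucc) (v i.succ)) (z : V) (i j : Fin (l + 1))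
    (hij : i ≤ j) (h : ∀ k, i ≤ k → k ≤ j → z ≠ v k) :
    InSameSCC (DelVertex E z) (v i) (v j) := by
  induction j using Fin.induction with
  | zero =>
    have : i = 0 := le_antisymm hij (Fin.zero_le _)
    subst this
    exact ⟨Relation.ReflTransGen.refl, Relation.ReflTransGen.refl⟩
  | succ j ih =>
    rcases hij.eq_or_lt with rfl | hlt
    · exact ⟨Relation.ReflTransGen.refl, Relation.ReflTransGen.refl⟩
    · have hle : i ≤ j.castSucc := Fin.le_castSucc_iff.mpr hlt
      have hjs : j.castSucc ≤ j.succ := Fin.castSucc_lt_succ.le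
      exact (ih hle fun k h1 h2 => h k h1 (h2.trans hjs)).transAux
        ((hchain j).2 z (h _ hle hjs) (h _ hij le_rfl))

theorem pair_aux {V : Type*} (E : V → V → Prop) (l : ℕ) (v : Fin (l + 1) → V)
    (hinj : Function.Injective v) (hcyc : Rel2s E (v 0) (v (Fin.last l)))
    (hchain : ∀ i : Fin l, Rel2s E (v i.castSucc) (v i.succ)) (z : V) (i j : Fin (l + 1))
    (hij : i ≤ j) (hi : z ≠ v i) (hj : z ≠ v j) :
    InSameSCC (DelVertex E z) (v i) (v j) := by
  by_cases h : ∀ k, i ≤ k → k ≤ j → z ≠ v k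
  · exact seg_aux E l v hchain z i j hij h
  · push Not at h
    obtain ⟨k, hik, hkj, rfl⟩ := h
    have h1 : i < k := lt_of_le_of_ne hik fun e => hi (by rw [e])
    have h2 : k < j := lt_of_le_of_ne hkj fun e => hj (by rw [e])
    have A : ∀ m, m ≤ i → v k ≠ v m := fun m hm e => (hm.trans_lt h1).ne' (hinj e)
    have B : ∀ m, j ≤ m → v k ≠ v m := fun m hm e => (h2.trans_le hm).ne (hinj e)
    have s1 := seg_aux E l v hchain (v k) 0 i (Fin.zero_le _) fun m _ hm => A m hm
    have s2 := seg_aux E l v hchain (v k) j (Fin.last l) (Fin.le_last _) fun m hm _ => B m hm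
    have s3 := hcyc.2 (v k) (A 0 (Fin.zero_le _)) (B _ (Fin.le_last _))
    exact (s1.symmAux.transAux s3).transAux s2.symmAux

/-- Lemma 10: if distinct vertices `v 0, …, v l` form a cycle under
`↔^{2s}`, then they all lie in one common 2-strong block. -/
theorem stmt9 {V : Type*} [Fintype V] (E : V → V → Prop)
    (hirr : ∀ v, ¬ E v v) (hsc : IsStronglyConn E)
    (l : ℕ) (v : Fin (l + 1) → V) (hinj : Function.Injective v)
    (hcyc : Rel2s E (v 0) (v (Fin.last l)))
    (hchain : ∀ i : Fin l, Rel2s E (v i.castSucc) (v i.succ)) :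
    ∃ C : Set V, IsMaxBlock (Rel2s E) 2 C ∧ ∀ i, v i ∈ C := by
  have hP : ∀ x ∈ Set.range v, ∀ y ∈ Set.range v, x ≠ y → Rel2s E x y := by
    rintro _ ⟨i, rfl⟩ _ ⟨j, rfl⟩ hne
    refine ⟨hne, fun z hi hj => ?_⟩
    rcases le_total i j with hij | hij
    · exact pair_aux E l v hinj hcyc hchain z i j hij hi hj
    · exact (pair_aux E l v hinj hcyc hchain z j i hij hj hi).symmAux
  obtain ⟨C, hle, hC⟩ := (Set.toFinite
    {C : Set V | ∀ x ∈ C, ∀ y ∈ C, x ≠ y → Rel2s E x y}).exists_le_maximal hP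
  refine ⟨C, ⟨?_, hC.1, fun D hCD hD => (hC.2 hD hCD).antisymm hCD⟩, fun i => hle ⟨i, rfl⟩⟩
  have h2 : ({v 0, v (Fin.last l)} : Set V).ncard = 2 := Set.ncard_pair hcyc.1
  rw [← h2]
  refine Set.ncard_le_ncard ?_ (Set.toFinite _)
  rintro x (rfl | rfl)
  · exact hle ⟨_, rfl⟩
  · exact hle ⟨_, rfl⟩
end

section
/- Let G = (V,E) be a strongly connected finite simple directed graph and let x, y be distinct vertices of G. Then there exist two edge-disjoint paths from x to y and two edge-disjoint paths from y to x in G if and only if for every edge e ∈ E, the vertices x and y lie in the same strongly connected component of the graph G − e obtained by deleting the edge e. -/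
variable {V : Type*}

namespace EDPAux

lemma edges_cons {V : Type*} (a b : V) (t : List V) :
    dipathEdges (a :: b :: t) = (a, b) :: dipathEdges (b :: t) := by
  simp [dipathEdges]

lemma exists_path {V : Type*} {R : V → V → Prop} {x y : V}
    (h : Relation.ReflTransGen R x y) : ∃ p, IsDipath R x y p := by
  induction h using Relation.ReflTransGen.head_induction_on with
  | refl => exact ⟨[y], by simp [IsDipath, List.Chain']⟩
  | @head a b hab _ ih =>
    obtain ⟨p, hc, hh, hl, hn⟩ := ih
    by_cases ha : a ∈ p
    · obtain ⟨s, t, rfl⟩ := List.append_of_mem ha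
      refine ⟨a :: t, (List.isChain_append.1 hc).2.1, rfl, ?_, (List.nodup_append.1 hn).2.1⟩
      rw [List.getLast?_append] at hl
      simpa [List.getLast?_cons] using hl
    · cases p with
      | nil => simp at hh
      | cons c t =>
        simp only [List.head?_cons, Option.some.injEq] at hh
        subst hh
        refine ⟨a :: c :: t, List.isChain_cons_cons.2 ⟨hab, hc⟩, rfl, ?_,
          List.nodup_cons.2 ⟨ha, hn⟩⟩
        rw [List.getLast?_cons_cons]
        exact hl

lemma edges_of_chain {V : Type*} {R : V → V → Prop} (p : List V) (h : List.IsChain R p) :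
    ∀ e ∈ dipathEdges p, R e.1 e.2 := by
  induction p with
  | nil => simp [dipathEdges]
  | cons a t ih =>
    cases t with
    | nil => simp [dipathEdges]
    | cons b t =>
      rw [edges_cons]
      rw [List.isChain_cons_cons] at h
      intro e he
      rcases List.mem_cons.1 he with rfl | he
      · exact h.1
      · exact ih h.2 e he

lemma reach_edges {V : Type*} (p : List V) (x y : V) (hh : p.head? = some x)
    (hl : p.getLast? = some y) :
    Relation.ReflTransGen (fun a b => (a, b) ∈ dipathEdges p) x y := by
  induction p generalizing x with
  | nil => simp at hh
  | cons a t ih =>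
    simp only [List.head?_cons, Option.some.injEq] at hh
    subst hh
    cases t with
    | nil =>
      simp at hl
      subst hl
      exact .refl
    | cons b t =>
      rw [List.getLast?_cons_cons] at hl
      have := ih b rfl hl
      rw [edges_cons]
      refine Relation.ReflTransGen.head (b := b) (by simp)
        (Relation.ReflTransGen.mono ?_ _ _ this)
      intro u v huv
      exact List.mem_cons_of_mem _ huv

lemma list_sum {V : Type*} (f : V → ℤ) (p : List V) (x y : V) (hh : p.head? = some x)
    (hl : p.getLast? = some y) :
    ((dipathEdges p).map (fun e => f e.1 - f e.2)).sum = f x - f y := by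
  induction p generalizing x with
  | nil => simp at hh
  | cons a t ih =>
    simp only [List.head?_cons, Option.some.injEq] at hh
    subst hh
    cases t with
    | nil =>
      simp at hl
      subst hl
      simp [dipathEdges]
    | cons b t =>
      rw [List.getLast?_cons_cons] at hl
      have := ih b rfl hl
      rw [edges_cons, List.map_cons, List.sum_cons, this]
      ring

lemma mem_of_edge {V : Type*} (p : List V) (e : V × V) (h : e ∈ dipathEdges p) : e.1 ∈ p :=
  (List.of_mem_zip (show (e.1, e.2) ∈ p.zip p.tail from h)).1

lemma edges_nodup {V : Type*} (p : List V) (h : p.Nodup) : (dipathEdges p).Nodup := by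
  induction p with
  | nil => simp [dipathEdges]
  | cons a t ih =>
    cases t with
    | nil => simp [dipathEdges]
    | cons b t =>
      rw [edges_cons]
      rw [List.nodup_cons] at h
      exact List.nodup_cons.2 ⟨fun hm => h.1 (mem_of_edge _ _ hm), ih h.2⟩

/-- `F` is a (balanced) edge set of flow value `k` from `x` to `y`. -/
def IsFlow {V : Type*} (x y : V) (F : Finset (V × V)) (k : ℤ) : Prop :=
  ∀ f : V → ℤ, ∑ e ∈ F, (f e.1 - f e.2) = k * (f x - f y)

lemma flow_path {V : Type*} [DecidableEq V] {R : V → V → Prop} {x y : V} {p : List V}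
    (h : IsDipath R x y p) : IsFlow x y (dipathEdges p).toFinset 1 := by
  intro f
  rw [List.sum_toFinset _ (edges_nodup p h.2.2.2), list_sum f p x y h.2.1 h.2.2.1, one_mul]

lemma flow_reach {V : Type*} {x y : V} {F : Finset (V × V)} {k : ℤ}
    (hF : IsFlow x y F k) (hk : 1 ≤ k) :
    Relation.ReflTransGen (fun a b => (a, b) ∈ F) x y := by
  classical
  by_contra hn
  have h := hF (fun v => if Relation.ReflTransGen (fun a b => (a, b) ∈ F) x v then 1 else 0)
  simp only [hn, if_false, Relation.ReflTransGen.refl, if_true] at h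
  have h2 := Finset.sum_nonpos (s := F) (f := fun e : V × V =>
    (if Relation.ReflTransGen (fun a b => (a, b) ∈ F) x e.1 then (1 : ℤ) else 0) -
    (if Relation.ReflTransGen (fun a b => (a, b) ∈ F) x e.2 then (1 : ℤ) else 0)) (by
      rintro ⟨a, b⟩ he
      by_cases ha : Relation.ReflTransGen (fun a b => (a, b) ∈ F) x a
      · have hb := ha.tail (show (fun a b => (a, b) ∈ F) a b from he)
        simp [ha, hb]
      · simp only [ha, if_false]
        split_ifs <;> simp)
  linarith

lemma twoEDP_of_flow {V : Type*} {E : V → V → Prop} {x y : V} {F : Finset (V × V)}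
    (hF : IsFlow x y F 2) (hE : ∀ e ∈ F, E e.1 e.2) : TwoEDP E x y := by
  classical
  obtain ⟨p, hp⟩ := exists_path (flow_reach hF (by norm_num))
  have hpF : (dipathEdges p).toFinset ⊆ F := by
    intro e he
    exact edges_of_chain p hp.1 e (List.mem_toFinset.1 he)
  have hF2 : IsFlow x y (F \ (dipathEdges p).toFinset) 1 := by
    intro f
    have h1 := Finset.sum_sdiff (f := fun e : V × V => f e.1 - f e.2) hpF
    have h2 := hF f
    have h3 := flow_path hp f
    linarith
  obtain ⟨q, hq⟩ := exists_path (flow_reach hF2 le_rfl)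
  refine ⟨p, q, ⟨List.IsChain.imp (fun a b h => hE (a, b) h) hp.1, hp.2⟩,
    ⟨List.IsChain.imp (fun a b h => hE (a, b) (Finset.mem_sdiff.1 h).1) hq.1, hq.2⟩, ?_⟩
  intro e he he2
  have := edges_of_chain q hq.1 e he2
  exact (Finset.mem_sdiff.1 this).2 (List.mem_toFinset.2 he)

lemma menger_two {V : Type*} {E : V → V → Prop} {x y : V}
    (hr : Relation.ReflTransGen E x y)
    (h : ∀ a b : V, E a b → Relation.ReflTransGen (fun p q => E p q ∧ ¬(p = a ∧ q = b)) x y) :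
    TwoEDP E x y := by
  classical
  obtain ⟨p, hp⟩ := exists_path hr
  obtain ⟨P, hPdef⟩ : ∃ P, P = (dipathEdges p).toFinset := ⟨_, rfl⟩
  have hP : IsFlow x y P 1 := hPdef ▸ flow_path hp
  have hPE : ∀ e ∈ P, E e.1 e.2 := by
    intro e he
    rw [hPdef] at he
    exact edges_of_chain p hp.1 e (List.mem_toFinset.1 he)
  by_cases hres : Relation.ReflTransGen
      (fun a b => (E a b ∧ (a, b) ∉ P) ∨ (b, a) ∈ P) x y
  · -- augment
    obtain ⟨q, hq⟩ := exists_path hres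
    obtain ⟨Q, hQdef⟩ : ∃ Q, Q = (dipathEdges q).toFinset := ⟨_, rfl⟩
    have hQ : IsFlow x y Q 1 := hQdef ▸ flow_path hq
    have hQR : ∀ e ∈ Q, (E e.1 e.2 ∧ e ∉ P) ∨ (e.2, e.1) ∈ P := by
      intro e he
      rw [hQdef] at he
      exact edges_of_chain q hq.1 e (List.mem_toFinset.1 he)
    have hdisj : Disjoint (P.filter (fun e => e.swap ∉ Q)) (Q.filter (fun e => e.swap ∉ P)) := by
      rw [Finset.disjoint_left]
      intro e he he2
      rw [Finset.mem_filter] at he he2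
      rcases hQR e he2.1 with h1 | h1
      · exact h1.2 he.1
      · exact he2.2 h1
    refine twoEDP_of_flow
      (F := (P.filter (fun e => e.swap ∉ Q)) ∪ (Q.filter (fun e => e.swap ∉ P))) ?_ ?_
    · intro f
      rw [Finset.sum_union hdisj]
      have h1 := Finset.sum_filter_add_sum_filter_not P (fun e => e.swap ∈ Q)
        (fun e : V × V => f e.1 - f e.2)
      have h2 := Finset.sum_filter_add_sum_filter_not Q (fun e => e.swap ∈ P)
        (fun e : V × V => f e.1 - f e.2)
      have h3 : ∑ e ∈ P.filter (fun e => e.swap ∈ Q), (f e.1 - f e.2)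
          = ∑ e ∈ Q.filter (fun e => e.swap ∈ P), -(f e.1 - f e.2) := by
        refine Finset.sum_bij' (fun e _ => e.swap) (fun e _ => e.swap) ?_ ?_ ?_ ?_ ?_
        · intro e he
          rw [Finset.mem_filter] at he ⊢
          simpa using he.symm
        · intro e he
          rw [Finset.mem_filter] at he ⊢
          simpa using he.symm
        · simp
        · simp
        · simp
      rw [Finset.sum_neg_distrib] at h3
      have h4 := hP f
      have h5 := hQ f
      linarith
    · intro e he
      rcases Finset.mem_union.1 he with he | he
      · exact hPE e (Finset.mem_filter.1 he).1
      · rw [Finset.mem_filter] at he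
        rcases hQR e he.1 with h1 | h1
        · exact h1.1
        · exact absurd h1 he.2
  · exfalso
    obtain ⟨S, hS⟩ : ∃ S : V → Prop, S = fun v => Relation.ReflTransGen
      (fun a b => (E a b ∧ (a, b) ∉ P) ∨ (b, a) ∈ P) x v := ⟨_, rfl⟩
    have hSx : S x := by rw [hS]
    have hSy : ¬ S y := by rw [hS]; exact hres
    have hback : ∀ a b, (a, b) ∈ P → S b → S a := by
      intro a b hab hb
      rw [hS] at hb ⊢
      exact hb.tail (Or.inr hab)
    have hfwd : ∀ a b, E a b → S a → ¬ S b → (a, b) ∈ P := by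
      intro a b hab ha hb
      by_contra hn
      apply hb
      rw [hS] at ha ⊢
      exact ha.tail (Or.inl ⟨hab, hn⟩)
    have hsum := hP (fun v => if S v then 1 else 0)
    simp only [hSx, hSy, if_true, if_false] at hsum
    have hnn : ∀ e ∈ P, (0 : ℤ) ≤ (if S e.1 then 1 else 0) - (if S e.2 then 1 else 0) := by
      rintro ⟨a, b⟩ he
      have := hback a b he
      by_cases hb : S b
      · simp [hb, this hb]
      · simp only [hb, if_false]
        split_ifs <;> simp
    obtain ⟨e, heP, hne⟩ := Finset.exists_ne_zero_of_sum_ne_zero (by rw [hsum]; norm_num)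
    have huniq : ∀ e' ∈ P, S e'.1 → ¬ S e'.2 → e' = e := by
      intro e' he' h1 h2
      by_contra hn
      have h3 := Finset.add_sum_erase P
        (fun e : V × V => (if S e.1 then (1 : ℤ) else 0) - (if S e.2 then 1 else 0)) heP
      have h4 := Finset.single_le_sum
        (f := fun e : V × V => (if S e.1 then (1 : ℤ) else 0) - (if S e.2 then 1 else 0))
        (s := P.erase e) (fun i hi => hnn i (Finset.mem_of_mem_erase hi))
        (Finset.mem_erase.2 ⟨hn, he'⟩)
      have h5 := hnn e heP
      simp only [h1, h2, if_true, if_false] at h4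
      omega
    have hreach := h e.1 e.2 (hPE e heP)
    apply hSy
    have key : ∀ v, Relation.ReflTransGen
        (fun p q => E p q ∧ ¬(p = e.1 ∧ q = e.2)) x v → S v := by
      intro v hv
      induction hv with
      | refl => exact hSx
      | @tail b c _ hbc ih =>
        by_contra hc
        have := huniq (b, c) (hfwd b c hbc.1 ih hc) ih hc
        apply hbc.2
        rw [← this]
        exact ⟨rfl, rfl⟩
    exact key y hreach

lemma reach_of_two {V : Type*} {E : V → V → Prop} {x y : V} (h : TwoEDP E x y) (a b : V) :
    Relation.ReflTransGen (fun p q => E p q ∧ ¬(p = a ∧ q = b)) x y := by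
  obtain ⟨p, q, hp, hq, hd⟩ := h
  have aux : ∀ r, IsDipath E x y r → (a, b) ∉ dipathEdges r →
      Relation.ReflTransGen (fun p q => E p q ∧ ¬(p = a ∧ q = b)) x y := by
    intro r hr hn
    refine Relation.ReflTransGen.mono ?_ _ _ (reach_edges r x y hr.2.1 hr.2.2.1)
    intro u v huv
    refine ⟨edges_of_chain r hr.1 (u, v) huv, ?_⟩
    rintro ⟨rfl, rfl⟩
    exact hn huv
  by_cases hm : (a, b) ∈ dipathEdges p
  · exact aux q hq (hd _ hm)
  · exact aux p hp hm

end EDPAux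

/-- Lemma 14: there are two edge-disjoint paths in both directions
between `x` and `y` iff for every edge `e`, the vertices `x, y` lie in the same SCC of
`G − e`. -/
theorem stmt10 {V : Type*} [Fintype V] (E : V → V → Prop)
    (hirr : ∀ v, ¬ E v v) (hsc : IsStronglyConn E) (x y : V) (hxy : x ≠ y) :
    (TwoEDP E x y ∧ TwoEDP E y x) ↔
      ∀ a b : V, E a b → InSameSCC (fun p q => E p q ∧ ¬(p = a ∧ q = b)) x y := by
  constructor
  · rintro ⟨h1, h2⟩ a b _
    exact ⟨EDPAux.reach_of_two h1 a b, EDPAux.reach_of_two h2 a b⟩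
  · intro h
    exact ⟨EDPAux.menger_two (hsc x y) (fun a b hab => (h a b hab).1),
      EDPAux.menger_two (hsc y x) (fun a b hab => (h a b hab).2)⟩
end
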